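/- Let λ, μ be partitions and let τ ≥ 0, 0 ≤ k ≤ λ_1 be integers. Then θ_k(λ, μ) (the ε = + construction) is the unique element [M'; L'] of Θ^{+,τ}_k(λ, μ) with the property that every [M''; L''] ∈ Θ^{+,τ}_k(λ, μ) satisfies M''_1 + ⋯ + M''_s ≥ M'_1 + ⋯ + M'_s and L''_1 + ⋯ + L''_t ≥ L'_1 + ⋯ + L'_t for all s, t ≥ 1; in other words, θ_k(λ, μ) is the unique simultaneous minimum of Θ^{+,τ}_k(λ, μ) in the dominance (partial-sum) order on both rows. -/

import Mathlib

/-- The weakly decreasing rearrangement of a weakly decreasing sequence `f`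
with one extra part `t` inserted. -/
def insertPart (t : ℕ) (f : ℕ → ℕ) : ℕ → ℕ
  | 0 => max (f 0) t
  | n + 1 => max (min (f n) t) (f (n + 1))

/-- A partition: a weakly decreasing sequence of naturals with
finitely many nonzero terms. -/
def IsPartition (f : ℕ → ℕ) : Prop := Antitone f ∧ ∃ N, ∀ n, N ≤ n → f n = 0

/-- The size `‖f‖` of a partition: the sum of its parts. -/
noncomputable def psize (f : ℕ → ℕ) : ℕ := ∑ᶠ n, f n

/-- Membership of the bipartition `[M; L]` in `Θ^{+,τ}_k(λ,μ)`:
`M_i ≥ μ_i ≥ M_{i+1}`, `λ_i ≥ L_i ≥ λ_{i+1}` for all `i`, with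
`‖M‖ = ‖μ‖ + τ + k` and `‖L‖ = ‖λ‖ - k`.  (All sequences are 0-indexed.) -/
def ThetaPlusMem (τ k : ℕ) (lam mu M L : ℕ → ℕ) : Prop :=
  IsPartition M ∧ IsPartition L ∧
  (∀ i, mu i ≤ M i ∧ M (i + 1) ≤ mu i) ∧
  (∀ i, L i ≤ lam i ∧ lam (i + 1) ≤ L i) ∧
  psize M = psize mu + τ + k ∧ psize L + k = psize lam

/-- Membership of the bipartition `[M; L]` in `Θ^{-,τ}_k(λ,μ)`:
`μ_i ≥ M_i ≥ μ_{i+1}`, `L_i ≥ λ_i ≥ L_{i+1}` for all `i`, with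
`‖M‖ = ‖μ‖ - k` and `‖L‖ = ‖λ‖ + τ + k`.  (All sequences are 0-indexed.) -/
def ThetaMinusMem (τ k : ℕ) (lam mu M L : ℕ → ℕ) : Prop :=
  IsPartition M ∧ IsPartition L ∧
  (∀ i, M i ≤ mu i ∧ mu (i + 1) ≤ M i) ∧
  (∀ i, lam i ≤ L i ∧ L (i + 1) ≤ lam i) ∧
  psize M + k = psize mu ∧ psize L = psize lam + τ + k

/-- Lexicographic order on sequences: `f` strictly precedes `g`. -/
def LexLt (f g : ℕ → ℕ) : Prop := ∃ i, (∀ j, j < i → f j = g j) ∧ f i < g i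

theorem psize_eq_sum_range {f : ℕ → ℕ} {N m : ℕ} (hN : ∀ n, N ≤ n → f n = 0) (hm : N ≤ m) :
    psize f = ∑ i ∈ Finset.range m, f i := by
  refine finsum_eq_sum_of_support_subset f fun n hn => ?_
  rw [Finset.coe_range, Set.mem_Iio]
  by_contra! h
  exact hn (hN n (hm.trans h))

theorem psize_eq_zero_add_shift {f : ℕ → ℕ} (hf : IsPartition f) :
    psize f = f 0 + psize fun n => f (n + 1) := by
  obtain ⟨-, N, hN⟩ := hf
  rw [psize_eq_sum_range hN N.le_succ, Finset.sum_range_succ', add_comm,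
    psize_eq_sum_range (f := fun n => f (n + 1)) (N := N) (fun n hn => hN _ (by lia)) le_rfl]

theorem IsPartition.shift {f : ℕ → ℕ} (hf : IsPartition f) : IsPartition fun n => f (n + 1) :=
  ⟨fun _ _ h => hf.1 (Nat.succ_le_succ h), hf.2.imp fun _ hN n hn => hN _ (by lia)⟩

theorem le_insertPart (t : ℕ) (f : ℕ → ℕ) (i : ℕ) : f i ≤ insertPart t f i := by
  cases i <;> simp [insertPart]

theorem insertPart_succ_le (t : ℕ) {f : ℕ → ℕ} (hf : Antitone f) (i : ℕ) :
    insertPart t f (i + 1) ≤ f i :=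
  max_le (min_le_left _ _) (hf i.le_succ)

theorem IsPartition.insertPart {f : ℕ → ℕ} (hf : IsPartition f) (t : ℕ) :
    IsPartition (insertPart t f) := by
  obtain ⟨hanti, N, hN⟩ := hf
  refine ⟨antitone_nat_of_succ_le fun n =>
    (insertPart_succ_le t hanti n).trans (le_insertPart t f n), N + 1, fun n hn => ?_⟩
  obtain ⟨n, rfl⟩ : ∃ m, n = m + 1 := ⟨n - 1, by lia⟩
  exact Nat.eq_zero_of_le_zero ((insertPart_succ_le t hanti n).trans (hN n (by lia)).le)

theorem sum_range_succ_insertPart (t : ℕ) {f : ℕ → ℕ} (hf : Antitone f) (n : ℕ) :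
    ∑ i ∈ Finset.range (n + 1), insertPart t f i + min (f n) t =
      ∑ i ∈ Finset.range (n + 1), f i + t := by
  induction n with
  | zero => simp [insertPart, max_add_min]
  | succ n ih =>
    rw [Finset.sum_range_succ, Finset.sum_range_succ f]
    have := hf n.le_succ
    have : insertPart t f (n + 1) = max (min (f n) t) (f (n + 1)) := rfl
    lia

theorem psize_insertPart (t : ℕ) {f : ℕ → ℕ} (hf : IsPartition f) :
    psize (insertPart t f) = psize f + t := by
  obtain ⟨N, hN⟩ := hf.2
  obtain ⟨K, hK⟩ := (hf.insertPart t).2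
  rw [psize_eq_sum_range hN (m := max N K + 1) (by lia),
    psize_eq_sum_range hK (m := max N K + 1) (by lia), ← sum_range_succ_insertPart t hf.1,
    hN (max N K) (le_max_left _ _), Nat.zero_min, add_zero]

/-- Among the sequences interlacing `f` from above and exceeding it by `t` in size,
`insertPart t f` has the smallest partial sums. -/
theorem sum_range_insertPart_le {t : ℕ} {f g : ℕ → ℕ} (hf : IsPartition f) (hg : IsPartition g)
    (hfg : ∀ i, f i ≤ g i) (hgf : ∀ i, g (i + 1) ≤ f i) (hsize : psize g = psize f + t) (s : ℕ) :
    ∑ i ∈ Finset.range s, insertPart t f i ≤ ∑ i ∈ Finset.range s, g i := by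
  cases s with
  | zero => simp
  | succ n =>
    have htail : ∀ m, n ≤ m → ∑ i ∈ Finset.range (m + 1), g i + ∑ i ∈ Finset.range n, f i ≤
        ∑ i ∈ Finset.range (n + 1), g i + ∑ i ∈ Finset.range m, f i := by
      intro m hm
      induction m, hm using Nat.le_induction with
      | base => rfl
      | succ m _ ih =>
        rw [Finset.sum_range_succ g (m + 1), Finset.sum_range_succ f m]
        have := hgf m
        lia
    obtain ⟨N, hN⟩ := hf.2
    obtain ⟨K, hK⟩ := hg.2
    have htotal := htail (max n (max N K)) (le_max_left _ _)
    rw [← psize_eq_sum_range hK (by lia),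
      ← psize_eq_sum_range hN (m := max n (max N K)) (by lia)] at htotal
    have hle : ∑ i ∈ Finset.range (n + 1), f i ≤ ∑ i ∈ Finset.range (n + 1), g i :=
      Finset.sum_le_sum fun i _ => hfg i
    have hins := sum_range_succ_insertPart t hf.1 n
    have hlast := Finset.sum_range_succ f n
    lia

theorem eq_of_sum_range_le {f g : ℕ → ℕ}
    (hfg : ∀ s, ∑ i ∈ Finset.range s, f i ≤ ∑ i ∈ Finset.range s, g i)
    (hgf : ∀ s, ∑ i ∈ Finset.range s, g i ≤ ∑ i ∈ Finset.range s, f i) : f = g := by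
  funext n
  have h := (hfg n).antisymm (hgf n)
  have h_succ := (hfg (n + 1)).antisymm (hgf (n + 1))
  rw [Finset.sum_range_succ, Finset.sum_range_succ] at h_succ
  lia

/-- Lemma 0413 (dominance form, ε = +): `θ_k(λ,μ)` is the unique element of
`Θ^{+,τ}_k(λ,μ)` whose two rows are simultaneously minimal in the dominance
(partial-sum) order among all elements of `Θ^{+,τ}_k(λ,μ)`. -/
theorem stmt16 (τ k : ℕ) (lam mu : ℕ → ℕ)
    (hlam : IsPartition lam) (hmu : IsPartition mu) (hk : k ≤ lam 0) :
    (ThetaPlusMem τ k lam mu (insertPart (τ + k) mu)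
        (insertPart (lam 0 - k) fun n => lam (n + 1)) ∧
      ∀ M'' L'', ThetaPlusMem τ k lam mu M'' L'' →
        (∀ s : ℕ, ∑ i ∈ Finset.range s, insertPart (τ + k) mu i ≤
          ∑ i ∈ Finset.range s, M'' i) ∧
        (∀ t : ℕ, ∑ i ∈ Finset.range t, insertPart (lam 0 - k) (fun n => lam (n + 1)) i ≤
          ∑ i ∈ Finset.range t, L'' i)) ∧
    ∀ M' L', (ThetaPlusMem τ k lam mu M' L' ∧
      ∀ M'' L'', ThetaPlusMem τ k lam mu M'' L'' →
        (∀ s : ℕ, ∑ i ∈ Finset.range s, M' i ≤ ∑ i ∈ Finset.range s, M'' i) ∧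
        (∀ t : ℕ, ∑ i ∈ Finset.range t, L' i ≤ ∑ i ∈ Finset.range t, L'' i)) →
      M' = insertPart (τ + k) mu ∧
      L' = insertPart (lam 0 - k) fun n => lam (n + 1) := by
  have hsize := psize_eq_zero_add_shift hlam
  have hmem : ThetaPlusMem τ k lam mu (insertPart (τ + k) mu)
      (insertPart (lam 0 - k) fun n => lam (n + 1)) := by
    refine ⟨hmu.insertPart _, hlam.shift.insertPart _,
      fun i => ⟨le_insertPart _ _ i, insertPart_succ_le _ hmu.1 i⟩,
      fun i => ⟨?_, le_insertPart _ (fun n => lam (n + 1)) i⟩, ?_, ?_⟩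
    · cases i with
      | zero => exact max_le (hlam.1 zero_le_one) (Nat.sub_le _ _)
      | succ i => exact insertPart_succ_le _ hlam.shift.1 i
    · rw [psize_insertPart _ hmu, add_assoc]
    · rw [psize_insertPart _ hlam.shift]
      lia
  have hmin : ∀ M L, ThetaPlusMem τ k lam mu M L →
      (∀ s : ℕ, ∑ i ∈ Finset.range s, insertPart (τ + k) mu i ≤ ∑ i ∈ Finset.range s, M i) ∧
      (∀ t : ℕ, ∑ i ∈ Finset.range t, insertPart (lam 0 - k) (fun n => lam (n + 1)) i ≤
        ∑ i ∈ Finset.range t, L i) := by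
    rintro M L ⟨hM, hL, hmuM, hlamL, hsizeM, hsizeL⟩
    exact ⟨sum_range_insertPart_le hmu hM (fun i => (hmuM i).1) (fun i => (hmuM i).2)
        (by rw [hsizeM, add_assoc]),
      sum_range_insertPart_le hlam.shift hL (fun i => (hlamL i).2)
        (fun i => (hlamL (i + 1)).1) (by lia)⟩
  refine ⟨⟨hmem, hmin⟩, ?_⟩
  rintro M L ⟨hML, hML_min⟩
  exact ⟨eq_of_sum_range_le (hML_min _ _ hmem).1 (hmin _ _ hML).1,
    eq_of_sum_range_le (hML_min _ _ hmem).2 (hmin _ _ hML).2⟩
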